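/- arXiv:1312.7142 — 2 statements merged into one kernel-verified Lean document; each statement's English description precedes it below -/
import Mathlib

section
/- (Seshadri–Wesołowski.) Let X and Y be two independent random variables, each positive almost surely and neither almost surely constant, such that E(1/X) < ∞ and E(X) < ∞. Set U = 1/(X + Y) and V = 1/X − 1/(X + Y). Suppose Y follows the Γ(p, a/2) distribution for some p > 0 and a > 0. If V is integrable and E(V | U) = c almost surely for a real constant c, then c > 0 and X follows the GIG(−p, a, b) distribution with b = 2p/c. -/
open MeasureTheory ProbabilityTheory Real Set Filter

/-- Unnormalized density of the GIG(p, a, b) distribution on (0, ∞). -/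
noncomputable def gigpdf (p a b : ℝ) (x : ℝ) : ℝ :=
  if 0 < x then x ^ (p - 1) * Real.exp (-(a * x + b / x) / 2) else 0

/-- Unnormalized density of the Gamma distribution with shape p and rate c on (0, ∞). -/
noncomputable def gampdf (p c : ℝ) (x : ℝ) : ℝ :=
  if 0 < x then x ^ (p - 1) * Real.exp (-(c * x)) else 0

/-- The law of `X` under `μ` has a Lebesgue density proportional to `g`. -/
def HasLawProp {Ω : Type*} [MeasurableSpace Ω] (μ : Measure Ω) (X : Ω → ℝ) (g : ℝ → ℝ) : Prop :=
  ∃ k : ℝ, 0 < k ∧ Measure.map X μ = volume.withDensity (fun x => ENNReal.ofReal (k * g x))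

/-- `X` follows the GIG(p, a, b) distribution under `μ`. -/
def HasLawGIG {Ω : Type*} [MeasurableSpace Ω] (μ : Measure Ω) (X : Ω → ℝ) (p a b : ℝ) : Prop :=
  HasLawProp μ X (gigpdf p a b)

/-- `X` follows the Gamma(p, c) distribution under `μ`. -/
def HasLawGamma {Ω : Type*} [MeasurableSpace Ω] (μ : Measure Ω) (X : Ω → ℝ) (p c : ℝ) : Prop :=
  HasLawProp μ X (gampdf p c)

/-- `U = 1/(X + Y)`. -/
noncomputable def uMY {Ω : Type*} (X Y : Ω → ℝ) (ω : Ω) : ℝ := 1 / (X ω + Y ω)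

/-- `V = 1/X - 1/(X + Y)`. -/
noncomputable def vMY {Ω : Type*} (X Y : Ω → ℝ) (ω : Ω) : ℝ := 1 / X ω - 1 / (X ω + Y ω)

/-- The `n`-th derivative of the moment generating function of a measure on `ℝ`,
written as an integral. -/
noncomputable def expMoment (ρ : Measure ℝ) (n : ℕ) (s : ℝ) : ℝ :=
  ∫ x, x ^ n * exp (s * x) ∂ρ

section LaplaceODE

variable {ρ ρ₁ ρ₂ : Measure ℝ}

lemma isFiniteMeasure_of_integrable_exp (hpos : ∀ᵐ x ∂ρ, 0 < x) (hint : Integrable exp ρ) :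
    IsFiniteMeasure ρ := by
  have h1 : Integrable (fun _ : ℝ => (1 : ℝ)) ρ := by
    refine hint.mono' (by fun_prop) ?_
    filter_upwards [hpos] with x hx
    simpa using hx.le
  simpa [integrable_const_iff] using h1

lemma mem_interior_integrableExpSet_of_lt_one (hpos : ∀ᵐ x ∂ρ, 0 < x) (hint : Integrable exp ρ)
    {s : ℝ} (hs : s < 1) : s ∈ interior (integrableExpSet id ρ) := by
  refine mem_interior.2 ⟨Iio 1, fun t ht => ?_, isOpen_Iio, hs⟩
  change Integrable (fun x => exp (t * id x)) ρ
  refine hint.mono' (by fun_prop) ?_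
  filter_upwards [hpos] with x hx
  have ht' : t < 1 := ht
  simp only [id, Real.norm_eq_abs, abs_exp, exp_le_exp]
  nlinarith

lemma integrable_pow_mul_exp_of_lt_one (hpos : ∀ᵐ x ∂ρ, 0 < x) (hint : Integrable exp ρ)
    (n : ℕ) {s : ℝ} (hs : s < 1) : Integrable (fun x => x ^ n * exp (s * x)) ρ :=
  integrable_pow_mul_exp_of_mem_interior_integrableExpSet
    (mem_interior_integrableExpSet_of_lt_one hpos hint hs) n

lemma hasDerivAt_expMoment (hpos : ∀ᵐ x ∂ρ, 0 < x) (hint : Integrable exp ρ)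
    (n : ℕ) {s : ℝ} (hs : s < 1) :
    HasDerivAt (expMoment ρ n) (expMoment ρ (n + 1) s) s :=
  hasDerivAt_integral_pow_mul_exp_real
    (mem_interior_integrableExpSet_of_lt_one hpos hint hs) n

lemma expMoment_nonneg (hpos : ∀ᵐ x ∂ρ, 0 < x) (n : ℕ) (s : ℝ) : 0 ≤ expMoment ρ n s := by
  refine integral_nonneg_of_ae ?_
  filter_upwards [hpos] with x hx
  simp only [Pi.zero_apply]
  positivity

lemma expMoment_zero_pos (hpos : ∀ᵐ x ∂ρ, 0 < x) (hint : Integrable exp ρ) (hρ : ρ ≠ 0)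
    {s : ℝ} (hs : s < 1) : 0 < expMoment ρ 0 s := by
  have := mgf_pos' (X := id) hρ
    (by simpa using integrable_pow_mul_exp_of_lt_one hpos hint 0 hs)
  simpa [mgf, expMoment] using this

lemma expMoment_le_of_nonpos (hpos : ∀ᵐ x ∂ρ, 0 < x) (hint : Integrable exp ρ)
    (n : ℕ) {s : ℝ} (hs : s ≤ 0) : expMoment ρ n s ≤ expMoment ρ n 0 := by
  refine integral_mono_ae (integrable_pow_mul_exp_of_lt_one hpos hint n (by linarith))
    (integrable_pow_mul_exp_of_lt_one hpos hint n zero_lt_one) ?_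
  filter_upwards [hpos] with x hx
  gcongr

/-- A solution of `dW/ds = -(p / (A - s)) W` on (-∞, 1) which is bounded at -∞ vanishes. -/
lemma wronskian_eq_zero {A p : ℝ} (hp : 0 < p) (hA : 1 ≤ A) {W : ℝ → ℝ} {B : ℝ}
    (hW : ∀ s < 1, HasDerivAt W (-(p / (A - s)) * W s) s) (hB : ∀ s ≤ 0, |W s| ≤ B)
    {s : ℝ} (hs : s < 1) : W s = 0 := by
  have hder : ∀ s < 1, HasDerivAt (fun s => W s * (A - s) ^ (-p)) 0 s := by
    intro s hs
    have hpos : 0 < A - s := by linarith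
    have h1 : HasDerivAt (fun s => (A - s) ^ (-p)) (-1 * (-p) * (A - s) ^ (-p - 1)) s :=
      ((hasDerivAt_id s).const_sub A).rpow_const (Or.inl hpos.ne')
    convert! (hW s hs).mul h1 using 1
    rw [rpow_sub_one hpos.ne']
    field_simp
    ring
  obtain ⟨C, hC⟩ := isOpen_Iio.exists_is_const_of_deriv_eq_zero (isPreconnected_Iio (a := (1 : ℝ)))
    (fun s hs => (hder s hs).differentiableAt.differentiableWithinAt)
    (fun s hs => (hder s hs).deriv)
  have hlim : Tendsto (fun s : ℝ => B * (A - s) ^ (-p)) atBot (nhds 0) := by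
    have h1 : Tendsto (fun s : ℝ => A - s) atBot atTop :=
      tendsto_atTop_add_const_left _ _ tendsto_neg_atBot_atTop
    simpa using ((tendsto_rpow_neg_atTop hp).comp h1).const_mul B
  have hC0 : |C| ≤ 0 := by
    refine ge_of_tendsto hlim ?_
    filter_upwards [eventually_le_atBot 0] with s hs
    have hpos : 0 < (A - s) ^ (-p) := rpow_pos_of_pos (by linarith) _
    rw [← hC s (show s < 1 by linarith), abs_mul, abs_of_pos hpos]
    exact mul_le_mul_of_nonneg_right (hB s hs) hpos.le
  have h0 := hC s hs
  rw [abs_nonpos_iff.1 hC0] at h0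
  exact (mul_eq_zero.1 h0).resolve_right (rpow_pos_of_pos (by linarith) _).ne'

lemma expMoment_proportional {A p c : ℝ} (hp : 0 < p) (hc : 0 < c) (hA : 1 ≤ A)
    (hpos₁ : ∀ᵐ x ∂ρ₁, 0 < x) (hint₁ : Integrable exp ρ₁)
    (hpos₂ : ∀ᵐ x ∂ρ₂, 0 < x) (hint₂ : Integrable exp ρ₂)
    (h₁0 : ρ₁ ≠ 0) (h₂0 : ρ₂ ≠ 0)
    (hode₁ : ∀ s < 1, c * (A - s) * expMoment ρ₁ 2 s + c * p * expMoment ρ₁ 1 s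
      = p * expMoment ρ₁ 0 s)
    (hode₂ : ∀ s < 1, c * (A - s) * expMoment ρ₂ 2 s + c * p * expMoment ρ₂ 1 s
      = p * expMoment ρ₂ 0 s) :
    ∃ k : ℝ, 0 < k ∧ ∀ s < 1, expMoment ρ₁ 0 s = k * expMoment ρ₂ 0 s := by
  have hd₁ n s hs := hasDerivAt_expMoment hpos₁ hint₁ n (s := s) hs
  have hd₂ n s hs := hasDerivAt_expMoment hpos₂ hint₂ n (s := s) hs
  have hW : ∀ s < 1, expMoment ρ₁ 0 s * expMoment ρ₂ 1 s
      - expMoment ρ₁ 1 s * expMoment ρ₂ 0 s = 0 := by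
    intro s hs
    refine wronskian_eq_zero (W := fun s => expMoment ρ₁ 0 s * expMoment ρ₂ 1 s
      - expMoment ρ₁ 1 s * expMoment ρ₂ 0 s)
      (B := expMoment ρ₁ 0 0 * expMoment ρ₂ 1 0 + expMoment ρ₁ 1 0 * expMoment ρ₂ 0 0)
      hp hA (fun s hs => ?_) (fun s hs => ?_) hs
    · have hpos : 0 < A - s := by linarith
      convert! ((hd₁ 0 s hs).mul (hd₂ 1 s hs)).sub ((hd₁ 1 s hs).mul (hd₂ 0 s hs)) using 1
      have e₁ := hode₁ s hs
      have e₂ := hode₂ s hs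
      field_simp
      refine mul_left_cancel₀ hc.ne' ?_
      simp only [Nat.reduceAdd]
      linear_combination (-expMoment ρ₁ 0 s) * e₂ + expMoment ρ₂ 0 s * e₁
    · have hl₁ n := expMoment_le_of_nonpos hpos₁ hint₁ n hs
      have hl₂ n := expMoment_le_of_nonpos hpos₂ hint₂ n hs
      have hn₁ n s := expMoment_nonneg hpos₁ n s
      have hn₂ n s := expMoment_nonneg hpos₂ n s
      refine (abs_sub _ _).trans ?_
      rw [abs_of_nonneg (mul_nonneg (hn₁ _ _) (hn₂ _ _)),
        abs_of_nonneg (mul_nonneg (hn₁ _ _) (hn₂ _ _))]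
      exact add_le_add (mul_le_mul (hl₁ 0) (hl₂ 1) (hn₂ _ _) (hn₁ _ _))
        (mul_le_mul (hl₁ 1) (hl₂ 0) (hn₂ _ _) (hn₁ _ _))
  have hq : ∀ s < 1, HasDerivAt (fun s => expMoment ρ₁ 0 s / expMoment ρ₂ 0 s) 0 s := by
    intro s hs
    convert! (hd₁ 0 s hs).div (hd₂ 0 s hs) (expMoment_zero_pos hpos₂ hint₂ h₂0 hs).ne' using 1
    have := hW s hs
    rw [eq_comm, div_eq_zero_iff]
    left
    simp only [zero_add]
    linarith
  obtain ⟨k, hk⟩ := isOpen_Iio.exists_is_const_of_deriv_eq_zero (isPreconnected_Iio (a := (1 : ℝ)))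
    (fun s hs => (hq s hs).differentiableAt.differentiableWithinAt)
    (fun s hs => (hq s hs).deriv)
  have hn s hs := expMoment_zero_pos hpos₂ hint₂ h₂0 (s := s) hs
  refine ⟨k, ?_, fun s hs => ?_⟩
  · rw [← hk 0 (show (0 : ℝ) < 1 by norm_num)]
    exact div_pos (expMoment_zero_pos hpos₁ hint₁ h₁0 zero_lt_one) (hn 0 zero_lt_one)
  · rw [← hk s hs, div_mul_cancel₀ _ (hn s hs).ne']

/-- A finite measure on `(0, ∞)` is determined by its moment generating function near `0`. -/
lemma measure_eq_of_expMoment_zero_eq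
    (hpos₁ : ∀ᵐ x ∂ρ₁, 0 < x) (hint₁ : Integrable exp ρ₁)
    (hpos₂ : ∀ᵐ x ∂ρ₂, 0 < x) (hint₂ : Integrable exp ρ₂)
    (h : ∀ s < 1, expMoment ρ₁ 0 s = expMoment ρ₂ 0 s) : ρ₁ = ρ₂ := by
  have := isFiniteMeasure_of_integrable_exp hpos₁ hint₁
  have := isFiniteMeasure_of_integrable_exp hpos₂ hint₂
  have han₁ : AnalyticOnNhd ℂ (complexMGF id ρ₁) {z | z.re < 1} := fun z hz =>
    analyticAt_complexMGF (mem_interior_integrableExpSet_of_lt_one hpos₁ hint₁ hz)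
  have han₂ : AnalyticOnNhd ℂ (complexMGF id ρ₂) {z | z.re < 1} := fun z hz =>
    analyticAt_complexMGF (mem_interior_integrableExpSet_of_lt_one hpos₂ hint₂ hz)
  have hfreq : ∃ᶠ z in nhdsWithin (0 : ℂ) {0}ᶜ, complexMGF id ρ₁ z = complexMGF id ρ₂ z := by
    have htend : Tendsto (fun x : ℝ => (x : ℂ)) (nhdsWithin 0 (Iio 0)) (nhdsWithin 0 {0}ᶜ) := by
      refine tendsto_nhdsWithin_iff.2 ⟨?_, ?_⟩
      · exact (Complex.continuous_ofReal.tendsto' 0 0 rfl).mono_left nhdsWithin_le_nhds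
      · filter_upwards [self_mem_nhdsWithin] with x hx
        simpa using (ne_of_lt hx)
    refine htend.frequently (Eventually.frequently ?_)
    filter_upwards [self_mem_nhdsWithin] with x hx
    have hx' : x < 0 := hx
    rw [complexMGF_ofReal, complexMGF_ofReal]
    simpa [mgf, expMoment] using h x (by linarith)
  have heq := han₁.eqOn_of_preconnected_of_frequently_eq han₂
    (convex_halfSpace_re_lt 1).isPreconnected (z₀ := 0) (by simp) hfreq
  refine Measure.ext_of_charFun (funext fun t => ?_)
  rw [← complexMGF_id_mul_I, ← complexMGF_id_mul_I]
  exact heq (by simp)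

lemma exists_smul_eq_of_laplace_ode {A p c : ℝ} (hp : 0 < p) (hc : 0 < c) (hA : 1 ≤ A)
    (hpos₁ : ∀ᵐ x ∂ρ₁, 0 < x) (hint₁ : Integrable exp ρ₁)
    (hpos₂ : ∀ᵐ x ∂ρ₂, 0 < x) (hint₂ : Integrable exp ρ₂)
    (h₁0 : ρ₁ ≠ 0) (h₂0 : ρ₂ ≠ 0)
    (hode₁ : ∀ s < 1, c * (A - s) * expMoment ρ₁ 2 s + c * p * expMoment ρ₁ 1 s
      = p * expMoment ρ₁ 0 s)
    (hode₂ : ∀ s < 1, c * (A - s) * expMoment ρ₂ 2 s + c * p * expMoment ρ₂ 1 s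
      = p * expMoment ρ₂ 0 s) :
    ∃ k : ℝ, 0 < k ∧ ρ₁ = ENNReal.ofReal k • ρ₂ := by
  obtain ⟨k, hk, h⟩ := expMoment_proportional hp hc hA hpos₁ hint₁ hpos₂ hint₂ h₁0 h₂0 hode₁ hode₂
  refine ⟨k, hk, measure_eq_of_expMoment_zero_eq hpos₁ hint₁ (Measure.ae_smul_measure hpos₂ _)
    (hint₂.smul_measure ENNReal.ofReal_ne_top) fun s hs => ?_⟩
  rw [h s hs, expMoment, expMoment, integral_smul_measure, ENNReal.toReal_ofReal hk.le, smul_eq_mul]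

end LaplaceODE

section GIGKernel

variable {t b : ℝ}

lemma integrableOn_rpow_mul_exp_neg_add_div (ht : 0 < t) (hb : 0 < b) (r : ℝ) :
    IntegrableOn (fun x => x ^ r * exp (-(t * x + b / (2 * x)))) (Ioi 0) := by
  obtain ⟨n, hn⟩ := exists_nat_gt (-1 - r)
  have hbase : IntegrableOn
      (fun x : ℝ => (n.factorial * (2 / b) ^ n) * (x ^ (r + n) * exp (-t * x ^ (1 : ℝ)))) (Ioi 0) :=
    (integrableOn_rpow_mul_exp_neg_mul_rpow (by linarith) one_pos ht).const_mul _
  refine Integrable.mono' hbase (by fun_prop) ?_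
  filter_upwards [ae_restrict_mem measurableSet_Ioi] with x hx
  have hx : 0 < x := hx
  have hexp : exp (-(b / (2 * x))) ≤ n.factorial * (2 / b) ^ n * x ^ n := by
    have hle := pow_div_factorial_le_exp (x := b / (2 * x)) (by positivity) n
    rw [exp_neg, inv_le_comm₀ (exp_pos _) (by positivity)]
    refine le_trans (le_of_eq ?_) hle
    rw [div_pow, div_pow, mul_pow]
    field_simp
  rw [Real.norm_of_nonneg (by positivity), neg_add, exp_add, rpow_add hx, rpow_natCast, rpow_one,
    neg_mul]
  calc x ^ r * (exp (-(t * x)) * exp (-(b / (2 * x))))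
      ≤ x ^ r * (exp (-(t * x)) * (n.factorial * (2 / b) ^ n * x ^ n)) := by gcongr
    _ = _ := by ring

lemma tendsto_rpow_mul_exp_neg_add_div_nhdsGT_zero (ht : 0 < t) (hb : 0 < b) (r : ℝ) :
    Tendsto (fun x => x ^ r * exp (-(t * x + b / (2 * x)))) (nhdsWithin 0 (Ioi 0)) (nhds 0) := by
  have h := (tendsto_rpow_mul_exp_neg_mul_atTop_nhds_zero (-r) (b / 2) (by positivity)).comp
    tendsto_inv_nhdsGT_zero
  refine squeeze_zero' ?_ ?_ h
  · filter_upwards [self_mem_nhdsWithin] with x hx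
    have hx : 0 < x := hx
    positivity
  · filter_upwards [self_mem_nhdsWithin] with x hx
    have hx : 0 < x := hx
    simp only [Function.comp]
    rw [inv_rpow hx.le, rpow_neg hx.le, inv_inv]
    gcongr
    have : b / 2 * x⁻¹ = b / (2 * x) := by field_simp
    have := mul_pos ht hx
    linarith

lemma tendsto_rpow_mul_exp_neg_add_div_atTop (ht : 0 < t) (hb : 0 < b) (r : ℝ) :
    Tendsto (fun x => x ^ r * exp (-(t * x + b / (2 * x)))) atTop (nhds 0) := by
  refine squeeze_zero' ?_ ?_ (tendsto_rpow_mul_exp_neg_mul_atTop_nhds_zero r t ht)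
  · filter_upwards [eventually_gt_atTop 0] with x hx
    positivity
  · filter_upwards [eventually_gt_atTop 0] with x hx
    gcongr
    have : 0 < b / (2 * x) := by positivity
    linarith

/-- Integration by parts for `x ^ (-p) * exp (-(t * x + b / (2 * x)))`. -/
lemma integral_rpow_mul_exp_neg_add_div_recurrence (ht : 0 < t) (hb : 0 < b) {p : ℝ} (hp : 0 < p) :
    t * (∫ x in Ioi 0, x ^ (-p) * exp (-(t * x + b / (2 * x))))
      + p * (∫ x in Ioi 0, x ^ (-p - 1) * exp (-(t * x + b / (2 * x))))
      = b / 2 * ∫ x in Ioi 0, x ^ (-p - 2) * exp (-(t * x + b / (2 * x))) := by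
  have hi := integrableOn_rpow_mul_exp_neg_add_div ht hb
  have key := integral_Ioi_of_hasDerivAt_of_tendsto (a := 0) (m := 0)
    (f := fun x => x ^ (-p) * exp (-(t * x + b / (2 * x))))
    (f' := fun x => b / 2 * (x ^ (-p - 2) * exp (-(t * x + b / (2 * x))))
      - (t * (x ^ (-p) * exp (-(t * x + b / (2 * x))))
        + p * (x ^ (-p - 1) * exp (-(t * x + b / (2 * x))))))
    ?_ ?_ ?_ (tendsto_rpow_mul_exp_neg_add_div_atTop ht hb (-p))
  · have h12 : IntegrableOn (fun x => t * (x ^ (-p) * exp (-(t * x + b / (2 * x))))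
        + p * (x ^ (-p - 1) * exp (-(t * x + b / (2 * x))))) (Ioi 0) :=
      ((hi (-p)).const_mul t).add ((hi (-p - 1)).const_mul p)
    rw [integral_sub ((hi (-p - 2)).const_mul _) h12,
      integral_add ((hi (-p)).const_mul t) ((hi (-p - 1)).const_mul p),
      integral_const_mul, integral_const_mul, integral_const_mul,
      zero_rpow (neg_ne_zero.2 hp.ne')] at key
    linarith
  · rw [← continuousWithinAt_Ioi_iff_Ici]
    have := tendsto_rpow_mul_exp_neg_add_div_nhdsGT_zero ht hb (-p)
    simpa [ContinuousWithinAt, zero_rpow (neg_ne_zero.2 hp.ne')] using this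
  · intro x hx
    have hx : 0 < x := hx
    have h1 : HasDerivAt (fun x : ℝ => x ^ (-p)) (-p * x ^ (-p - 1)) x :=
      hasDerivAt_rpow_const (Or.inl hx.ne')
    have h2 : HasDerivAt (fun x : ℝ => -(t * x + b / (2 * x))) (-(t - b / (2 * x ^ 2))) x := by
      have h3 : HasDerivAt (fun x : ℝ => b / (2 * x)) (-(b / (2 * x ^ 2))) x := by
        convert! (hasDerivAt_const x b).div ((hasDerivAt_id x).const_mul 2)
          (by simpa using hx.ne') using 1
        simp only [id]
        field_simp
        ring
      convert! (((hasDerivAt_id x).const_mul t).add h3).neg using 1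
      ring
    convert! h1.mul h2.exp using 1
    have e2 : x ^ (-p - 2) = x ^ (-p) / x ^ 2 := by
      rw [rpow_sub hx, rpow_two]
    rw [e2, rpow_sub_one hx.ne']
    field_simp
    ring
  · exact ((hi (-p - 2)).const_mul _).sub
      (((hi (-p)).const_mul t).add ((hi (-p - 1)).const_mul p))

end GIGKernel

section GIGMeasure

variable {p a b : ℝ}

lemma gigpdf_nonneg (p a b x : ℝ) : 0 ≤ gigpdf p a b x := by
  unfold gigpdf
  split_ifs <;> positivity

lemma measurable_gigpdf (p a b : ℝ) : Measurable (gigpdf p a b) := by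
  unfold gigpdf
  exact Measurable.ite measurableSet_Ioi (by fun_prop) measurable_const

/-- The measure with density `x⁻¹ * exp (-x)` with respect to `ν`. -/
noncomputable def invExpTilt (ν : Measure ℝ) : Measure ℝ :=
  ν.withDensity fun x => ENNReal.ofReal (x⁻¹ * exp (-x))

variable {ν : Measure ℝ}

lemma ae_pos_invExpTilt (hpos : ∀ᵐ x ∂ν, 0 < x) : ∀ᵐ x ∂(invExpTilt ν), 0 < x :=
  (withDensity_absolutelyContinuous _ _).ae_le hpos

lemma withDensity_invExpTilt (hpos : ∀ᵐ x ∂ν, 0 < x) :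
    (invExpTilt ν).withDensity (fun x => ENNReal.ofReal (x * exp x)) = ν := by
  rw [invExpTilt, ← withDensity_mul _ (by fun_prop) (by fun_prop)]
  conv_rhs => rw [← withDensity_one (μ := ν)]
  refine withDensity_congr_ae ?_
  filter_upwards [hpos] with x hx
  simp only [Pi.mul_apply, Pi.one_apply]
  rw [← ENNReal.ofReal_mul (by positivity), ← ENNReal.ofReal_one, exp_neg]
  congr 1
  field_simp

lemma invExpTilt_ne_zero (hpos : ∀ᵐ x ∂ν, 0 < x) (hν : ν ≠ 0) : invExpTilt ν ≠ 0 := by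
  intro h
  have := withDensity_invExpTilt hpos
  rw [h, withDensity_zero_left] at this
  exact hν this.symm

lemma integrable_exp_invExpTilt (hpos : ∀ᵐ x ∂ν, 0 < x) (hint : Integrable (fun x => x⁻¹) ν) :
    Integrable exp (invExpTilt ν) := by
  rw [invExpTilt, integrable_withDensity_iff_integrable_smul' (by fun_prop)
    (ae_of_all _ fun _ => ENNReal.ofReal_lt_top)]
  refine hint.congr ?_
  filter_upwards [hpos] with x hx
  rw [ENNReal.toReal_ofReal (by positivity), smul_eq_mul, mul_assoc, ← exp_add]
  simp

lemma expMoment_invExpTilt (hpos : ∀ᵐ x ∂ν, 0 < x) (n : ℕ) (s : ℝ) :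
    expMoment (invExpTilt ν) n s = ∫ x, x⁻¹ * x ^ n * exp (-((1 - s) * x)) ∂ν := by
  rw [invExpTilt, expMoment, integral_withDensity_eq_integral_toReal_smul (by fun_prop)
    (ae_of_all _ fun _ => ENNReal.ofReal_lt_top)]
  refine integral_congr_ae ?_
  filter_upwards [hpos] with x hx
  rw [ENNReal.toReal_ofReal (by positivity), smul_eq_mul,
    show -((1 - s) * x) = -x + s * x by ring, exp_add]
  ring

/-- The unnormalized GIG measure. -/
noncomputable def gigMeasure (p a b : ℝ) : Measure ℝ :=
  volume.withDensity fun x => ENNReal.ofReal (gigpdf p a b x)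

lemma ae_pos_gigMeasure (p a b : ℝ) : ∀ᵐ x ∂(gigMeasure p a b), 0 < x := by
  rw [gigMeasure, ae_withDensity_iff (measurable_gigpdf p a b).ennreal_ofReal]
  refine ae_of_all _ fun x hx => ?_
  by_contra h
  simp [gigpdf, h] at hx

lemma gigpdf_mul_eq_indicator (p a b : ℝ) (g : ℝ → ℝ) :
    (fun x => gigpdf p a b x * g x) = (Ioi 0).indicator
      fun x => x ^ (p - 1) * exp (-(a * x + b / x) / 2) * g x := by
  ext x
  by_cases hx : 0 < x <;> simp [gigpdf, hx]

lemma integrable_gigMeasure_iff (p a b : ℝ) (g : ℝ → ℝ) : Integrable g (gigMeasure p a b) ↔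
    IntegrableOn (fun x => x ^ (p - 1) * exp (-(a * x + b / x) / 2) * g x) (Ioi 0) := by
  rw [gigMeasure, integrable_withDensity_iff_integrable_smul'
    (measurable_gigpdf p a b).ennreal_ofReal (ae_of_all _ fun _ => ENNReal.ofReal_lt_top)]
  simp only [ENNReal.toReal_ofReal (gigpdf_nonneg _ _ _ _), smul_eq_mul]
  rw [gigpdf_mul_eq_indicator, integrable_indicator_iff measurableSet_Ioi]

lemma integral_gigMeasure (p a b : ℝ) (g : ℝ → ℝ) : ∫ x, g x ∂(gigMeasure p a b) =
    ∫ x in Ioi 0, x ^ (p - 1) * exp (-(a * x + b / x) / 2) * g x := by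
  rw [gigMeasure, integral_withDensity_eq_integral_toReal_smul
    (measurable_gigpdf p a b).ennreal_ofReal (ae_of_all _ fun _ => ENNReal.ofReal_lt_top)]
  simp only [ENNReal.toReal_ofReal (gigpdf_nonneg _ _ _ _), smul_eq_mul]
  rw [gigpdf_mul_eq_indicator, integral_indicator measurableSet_Ioi]

lemma gigMeasure_ne_zero (p a b : ℝ) : gigMeasure p a b ≠ 0 := by
  intro h
  rw [gigMeasure, withDensity_eq_zero_iff
    (measurable_gigpdf p a b).ennreal_ofReal.aemeasurable] at h
  have h0 : volume (Ioi (0 : ℝ)) = 0 := by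
    refine measure_mono_null (fun x (hx : 0 < x) => ?_) h
    have : 0 < x ^ (p - 1) * exp (-(a * x + b / x) / 2) := by positivity
    simpa [gigpdf, hx] using this
  simp at h0

lemma integrable_inv_gigMeasure (ha : 0 < a) (hb : 0 < b) :
    Integrable (fun x => x⁻¹) (gigMeasure p a b) := by
  rw [integrable_gigMeasure_iff]
  refine (integrableOn_rpow_mul_exp_neg_add_div (t := a / 2) (by positivity) hb
    (p - 2)).congr_fun (fun x (hx : 0 < x) => ?_) measurableSet_Ioi
  have h1 : x ^ (p - 1) = x ^ (p - 2) * x := by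
    rw [← rpow_add_one hx.ne']
    ring_nf
  have h2 : -(a * x + b / x) / 2 = -(a / 2 * x + b / (2 * x)) := by
    field_simp
  simp only [h1, h2]
  field_simp

lemma expMoment_invExpTilt_gigMeasure (p a b : ℝ) (n : ℕ) (s : ℝ) :
    expMoment (invExpTilt (gigMeasure p a b)) n s =
      ∫ x in Ioi 0, x ^ (p - 2 + n) * exp (-((1 + a / 2 - s) * x + b / (2 * x))) := by
  rw [expMoment_invExpTilt (ae_pos_gigMeasure p a b), integral_gigMeasure]
  refine setIntegral_congr_fun measurableSet_Ioi fun x (hx : 0 < x) => ?_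
  have h1 : x ^ (p - 1) = x ^ (p - 2) * x := by
    rw [← rpow_add_one hx.ne']
    ring_nf
  have h2 : -((1 + a / 2 - s) * x + b / (2 * x)) =
      -(a * x + b / x) / 2 + -((1 - s) * x) := by
    field_simp
    ring
  simp only [h1, h2, exp_add, rpow_add hx, rpow_natCast]
  field_simp

lemma expMoment_gigMeasure_ode {c : ℝ} (hp : 0 < p) (ha : 0 < a) (hc : 0 < c) {s : ℝ}
    (hs : s < 1) :
    c * (1 + a / 2 - s) * expMoment (invExpTilt (gigMeasure (-p) a (2 * p / c))) 2 s
      + c * p * expMoment (invExpTilt (gigMeasure (-p) a (2 * p / c))) 1 s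
      = p * expMoment (invExpTilt (gigMeasure (-p) a (2 * p / c))) 0 s := by
  have key := integral_rpow_mul_exp_neg_add_div_recurrence (t := 1 + a / 2 - s)
    (b := 2 * p / c) (by linarith) (by positivity) hp
  simp only [expMoment_invExpTilt_gigMeasure]
  have e2 : -p - 2 + (2 : ℕ) = -p := by norm_num
  have e1 : -p - 2 + (1 : ℕ) = -p - 1 := by norm_num; ring
  have e0 : -p - 2 + (0 : ℕ) = -p - 2 := by norm_num
  rw [e0, e1, e2]
  have hcp : c * (2 * p / c / 2) = p := by field_simp
  linear_combination c * key + (∫ x in Ioi 0, x ^ (-p - 2) *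
    exp (-((1 + a / 2 - s) * x + 2 * p / c / (2 * x)))) * hcp

end GIGMeasure

section Regression

variable {Ω : Type*} [MeasurableSpace Ω] {μ : Measure Ω} {X Y : Ω → ℝ}

lemma integral_comp_of_hasLawGamma {p r k : ℝ} (hk : 0 < k) (hYm : Measurable Y)
    (hY : Measure.map Y μ = volume.withDensity fun x => ENNReal.ofReal (k * gampdf p r x))
    {g : ℝ → ℝ} (hg : Measurable g) :
    ∫ ω, g (Y ω) ∂μ = k * ∫ y in Ioi 0, y ^ (p - 1) * exp (-(r * y)) * g y := by
  have hnn : ∀ x, 0 ≤ k * gampdf p r x := fun x => by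
    unfold gampdf
    split_ifs <;> positivity
  have hm : Measurable (gampdf p r) := by
    unfold gampdf
    exact Measurable.ite measurableSet_Ioi (by fun_prop) measurable_const
  rw [← integral_map hYm.aemeasurable (f := g) hg.aestronglyMeasurable, hY,
    integral_withDensity_eq_integral_toReal_smul
    (hm.const_mul k).ennreal_ofReal (ae_of_all _ fun _ => ENNReal.ofReal_lt_top)]
  simp only [ENNReal.toReal_ofReal (hnn _), smul_eq_mul, mul_assoc]
  rw [integral_const_mul, ← integral_indicator measurableSet_Ioi]
  congr 2
  ext x
  by_cases hx : 0 < x <;> simp [gampdf, hx, mul_assoc]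

/-- `E[Y exp(-θ Y)] = (p / (r + θ)) E[exp(-θ Y)]` for `Y ~ Γ(p, r)`. -/
lemma HasLawGamma.integral_mul_exp {p r : ℝ} (hY : HasLawGamma μ Y p r) (hYm : Measurable Y)
    (hp : 0 < p) (hr : 0 < r) {θ : ℝ} (hθ : 0 < θ) :
    (r + θ) * ∫ ω, Y ω * exp (-(θ * Y ω)) ∂μ = p * ∫ ω, exp (-(θ * Y ω)) ∂μ := by
  obtain ⟨k, hk, hlaw⟩ := hY
  have hrθ : 0 < r + θ := by positivity
  rw [integral_comp_of_hasLawGamma hk hYm hlaw (g := fun y => y * exp (-(θ * y))) (by fun_prop),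
    integral_comp_of_hasLawGamma hk hYm hlaw (g := fun y => exp (-(θ * y))) (by fun_prop)]
  have e1 : ∫ y in Ioi 0, y ^ (p - 1) * exp (-(r * y)) * (y * exp (-(θ * y)))
      = (1 / (r + θ)) ^ (p + 1) * Gamma (p + 1) := by
    rw [← integral_rpow_mul_exp_neg_mul_Ioi (by linarith) hrθ]
    refine setIntegral_congr_fun measurableSet_Ioi fun y (hy : 0 < y) => ?_
    simp only [add_sub_cancel_right]
    rw [rpow_sub_one hy.ne', show -((r + θ) * y) = -(r * y) + -(θ * y) by ring, exp_add]
    field_simp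
  have e0 : ∫ y in Ioi 0, y ^ (p - 1) * exp (-(r * y)) * exp (-(θ * y))
      = (1 / (r + θ)) ^ p * Gamma p := by
    rw [← integral_rpow_mul_exp_neg_mul_Ioi hp hrθ]
    refine setIntegral_congr_fun measurableSet_Ioi fun y (hy : 0 < y) => ?_
    rw [show -((r + θ) * y) = -(r * y) + -(θ * y) by ring, exp_add, mul_assoc]
  rw [e1, e0, Gamma_add_one hp.ne', rpow_add_one (by positivity)]
  field_simp

lemma mul_exp_neg_le_inv {θ x : ℝ} (hθ : 0 < θ) : x * exp (-(θ * x)) ≤ θ⁻¹ := by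
  have h := add_one_le_exp (θ * x)
  rw [exp_neg, ← div_eq_mul_inv, div_le_iff₀ (exp_pos _)]
  rw [inv_mul_eq_div, le_div_iff₀ hθ]
  linarith

lemma integrable_mul_exp_neg [IsFiniteMeasure μ] (hXm : Measurable X) (hXpos : ∀ᵐ ω ∂μ, 0 < X ω)
    {θ : ℝ} (hθ : 0 < θ) : Integrable (fun ω => X ω * exp (-(θ * X ω))) μ := by
  refine Integrable.of_bound (by fun_prop) θ⁻¹ ?_
  filter_upwards [hXpos] with ω hω
  rw [Real.norm_of_nonneg (by positivity)]
  exact mul_exp_neg_le_inv hθ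

lemma integrable_exp_neg_mul [IsFiniteMeasure μ] (hXm : Measurable X) (hXpos : ∀ᵐ ω ∂μ, 0 < X ω)
    {θ : ℝ} (hθ : 0 < θ) : Integrable (fun ω => exp (-(θ * X ω))) μ := by
  refine Integrable.of_bound (by fun_prop) 1 ?_
  filter_upwards [hXpos] with ω hω
  rw [Real.norm_of_nonneg (by positivity), exp_le_one_iff]
  have := mul_pos hθ hω
  linarith

lemma measurable_uMY (hXm : Measurable X) (hYm : Measurable Y) : Measurable (uMY X Y) := by
  unfold uMY
  fun_prop

lemma regression_const_pos [IsProbabilityMeasure μ] (hXm : Measurable X) (hYm : Measurable Y)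
    (hXpos : ∀ᵐ ω ∂μ, 0 < X ω) (hYpos : ∀ᵐ ω ∂μ, 0 < Y ω) (hVint : Integrable (vMY X Y) μ) {c : ℝ}
    (hc : μ[vMY X Y | MeasurableSpace.comap (uMY X Y) inferInstance] =ᵐ[μ] fun _ => c) :
    0 < c := by
  have hEV : ∫ ω, vMY X Y ω ∂μ = c := by
    rw [← integral_condExp (measurable_uMY hXm hYm).comap_le, integral_congr_ae hc]
    simp
  have hVpos : ∀ᵐ ω ∂μ, 0 < vMY X Y ω := by
    filter_upwards [hXpos, hYpos] with ω hx hy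
    exact sub_pos.2 (one_div_lt_one_div_of_lt hx (by linarith))
  rw [← hEV, integral_pos_iff_support_of_nonneg_ae (hVpos.mono fun _ h => h.le) hVint]
  have hsupp : Function.support (vMY X Y) =ᵐ[μ] univ :=
    eventuallyEq_univ.2 (hVpos.mono fun _ h => h.ne')
  rw [measure_congr hsupp]
  simp

/-- The constant regression of `V` on `U`, tested against `S * exp(-θ S)` with `S = X + Y`. -/
lemma integral_regression_identity [IsProbabilityMeasure μ]
    (hXm : Measurable X) (hYm : Measurable Y)
    (hXpos : ∀ᵐ ω ∂μ, 0 < X ω) (hYpos : ∀ᵐ ω ∂μ, 0 < Y ω) (hindep : IndepFun X Y μ)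
    (hVint : Integrable (vMY X Y) μ) {c : ℝ}
    (hc : μ[vMY X Y | MeasurableSpace.comap (uMY X Y) inferInstance] =ᵐ[μ] fun _ => c)
    {θ : ℝ} (hθ : 0 < θ) :
    (∫ ω, (X ω)⁻¹ * exp (-(θ * X ω)) ∂μ) * (∫ ω, Y ω * exp (-(θ * Y ω)) ∂μ)
      = c * ((∫ ω, X ω * exp (-(θ * X ω)) ∂μ) * (∫ ω, exp (-(θ * Y ω)) ∂μ)
        + (∫ ω, exp (-(θ * X ω)) ∂μ) * (∫ ω, Y ω * exp (-(θ * Y ω)) ∂μ)) := by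
  set U := uMY X Y with hU
  have hUm : Measurable U := measurable_uMY hXm hYm
  let f : Ω → ℝ := fun ω => (U ω)⁻¹ * exp (-(θ * (U ω)⁻¹))
  have hfeq : ∀ ω, f ω = (X ω + Y ω) * exp (-(θ * (X ω + Y ω))) := fun ω => by
    simp [f, hU, uMY]
  have hfm : StronglyMeasurable[MeasurableSpace.comap U inferInstance] f := by
    have hg : Measurable fun u : ℝ => u⁻¹ * exp (-(θ * u⁻¹)) := by fun_prop
    exact (hg.comp (comap_measurable U)).stronglyMeasurable
  have hSpos : ∀ᵐ ω ∂μ, 0 < X ω + Y ω := by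
    filter_upwards [hXpos, hYpos] with ω hx hy
    positivity
  have hfm' : AEStronglyMeasurable f μ := (hfm.mono hUm.comap_le).aestronglyMeasurable
  have hfV : Integrable (f * vMY X Y) μ := by
    refine hVint.bdd_mul (c := θ⁻¹) hfm' ?_
    filter_upwards [hSpos] with ω hω
    rw [hfeq, Real.norm_of_nonneg (by positivity)]
    exact mul_exp_neg_le_inv hθ
  have hmain : ∫ ω, f ω * vMY X Y ω ∂μ = c * ∫ ω, f ω ∂μ := by
    have h1 := condExp_mul_of_stronglyMeasurable_left hfm hfV hVint
    have h2 := integral_condExp (μ := μ) (f := f * vMY X Y) hUm.comap_le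
    rw [integral_congr_ae h1] at h2
    rw [← integral_const_mul]
    refine h2.symm.trans (integral_congr_ae ?_)
    filter_upwards [hc] with ω hω
    rw [Pi.mul_apply, hω, mul_comm]
  have hXe := integrable_exp_neg_mul hXm hXpos hθ
  have hYe := integrable_exp_neg_mul hYm hYpos hθ
  have hXX := integrable_mul_exp_neg hXm hXpos hθ
  have hYY := integrable_mul_exp_neg hYm hYpos hθ
  have hme : Measurable fun x : ℝ => exp (-(θ * x)) := by fun_prop
  have hmx : Measurable fun x : ℝ => x * exp (-(θ * x)) := by fun_prop
  have hmi : Measurable fun x : ℝ => x⁻¹ * exp (-(θ * x)) := by fun_prop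
  have hleft : ∫ ω, f ω * vMY X Y ω ∂μ
      = ∫ ω, ((X ω)⁻¹ * exp (-(θ * X ω))) * (Y ω * exp (-(θ * Y ω))) ∂μ := by
    refine integral_congr_ae ?_
    filter_upwards [hXpos, hSpos] with ω hx hs
    simp only [hfeq, vMY, mul_add, neg_add, exp_add]
    field_simp
    ring
  have hright : ∫ ω, f ω ∂μ = (∫ ω, (X ω * exp (-(θ * X ω))) * exp (-(θ * Y ω)) ∂μ)
      + ∫ ω, exp (-(θ * X ω)) * (Y ω * exp (-(θ * Y ω))) ∂μ := by
    refine Eq.trans ?_ (integral_add ((hindep.comp hmx hme).integrable_mul hXX hYe)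
      ((hindep.comp hme hmx).integrable_mul hXe hYY))
    refine integral_congr_ae (ae_of_all _ fun ω => ?_)
    simp only [hfeq, mul_add, neg_add, exp_add]
    ring
  have h1 := (hindep.comp hmi hmx).integral_fun_mul_eq_mul_integral
    (by fun_prop) (by fun_prop)
  have h2 := (hindep.comp hmx hme).integral_fun_mul_eq_mul_integral
    (by fun_prop) (by fun_prop)
  have h3 := (hindep.comp hme hmx).integral_fun_mul_eq_mul_integral
    (by fun_prop) (by fun_prop)
  simp only [Function.comp_def] at h1 h2 h3
  rw [hleft, hright, h1, h2, h3] at hmain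
  exact hmain

lemma expMoment_map_ode [IsProbabilityMeasure μ]
    (hXm : Measurable X) (hYm : Measurable Y)
    (hXpos : ∀ᵐ ω ∂μ, 0 < X ω) (hYpos : ∀ᵐ ω ∂μ, 0 < Y ω) (hindep : IndepFun X Y μ)
    {p a : ℝ} (hp : 0 < p) (ha : 0 < a) (hY : HasLawGamma μ Y p (a / 2))
    (hVint : Integrable (vMY X Y) μ) {c : ℝ}
    (hc : μ[vMY X Y | MeasurableSpace.comap (uMY X Y) inferInstance] =ᵐ[μ] fun _ => c)
    {s : ℝ} (hs : s < 1) :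
    c * (1 + a / 2 - s) * expMoment (invExpTilt (μ.map X)) 2 s
      + c * p * expMoment (invExpTilt (μ.map X)) 1 s
      = p * expMoment (invExpTilt (μ.map X)) 0 s := by
  have hθ : 0 < 1 - s := by linarith
  have hposmap : ∀ᵐ x ∂(μ.map X), 0 < x :=
    (ae_map_iff hXm.aemeasurable measurableSet_Ioi).2 hXpos
  have hmom : ∀ n, expMoment (invExpTilt (μ.map X)) n s
      = ∫ ω, (X ω)⁻¹ * X ω ^ n * exp (-((1 - s) * X ω)) ∂μ := fun n => by
    rw [expMoment_invExpTilt hposmap, integral_map hXm.aemeasurable (by fun_prop)]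
  have h2 : expMoment (invExpTilt (μ.map X)) 2 s
      = ∫ ω, X ω * exp (-((1 - s) * X ω)) ∂μ := by
    rw [hmom]
    refine integral_congr_ae ?_
    filter_upwards [hXpos] with ω hω
    field_simp
  have h1 : expMoment (invExpTilt (μ.map X)) 1 s = ∫ ω, exp (-((1 - s) * X ω)) ∂μ := by
    rw [hmom]
    refine integral_congr_ae ?_
    filter_upwards [hXpos] with ω hω
    field_simp
  have h0 : expMoment (invExpTilt (μ.map X)) 0 s
      = ∫ ω, (X ω)⁻¹ * exp (-((1 - s) * X ω)) ∂μ := by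
    simp [hmom]
  have hreg := integral_regression_identity hXm hYm hXpos hYpos hindep hVint hc hθ
  have hgam := hY.integral_mul_exp hYm hp (by positivity) hθ
  rw [← h0, ← h1, ← h2] at hreg
  have hq : 0 < ∫ ω, exp (-((1 - s) * Y ω)) ∂μ :=
    integral_exp_pos (integrable_exp_neg_mul hYm hYpos hθ)
  refine mul_right_cancel₀ hq.ne' ?_
  linear_combination (-(1 + a / 2 - s)) * hreg
    + (expMoment (invExpTilt (μ.map X)) 0 s - c * expMoment (invExpTilt (μ.map X)) 1 s) * hgam

end Regression

/-- Seshadri–Wesołowski: if `Y ~ Γ(p, a/2)` and `V` has constant regression `c` on `U`,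
then `c > 0` and `X ~ GIG(-p, a, 2p/c)`. -/
theorem seshadri_wesolowski_gig_from_gamma
    {Ω : Type*} [MeasurableSpace Ω] (μ : Measure Ω) [IsProbabilityMeasure μ]
    (X Y : Ω → ℝ) (hXm : Measurable X) (hYm : Measurable Y)
    (hXpos : ∀ᵐ ω ∂μ, 0 < X ω) (hYpos : ∀ᵐ ω ∂μ, 0 < Y ω)
    (hXnd : ¬ ∃ k : ℝ, ∀ᵐ ω ∂μ, X ω = k) (hYnd : ¬ ∃ k : ℝ, ∀ᵐ ω ∂μ, Y ω = k)
    (hindep : IndepFun X Y μ)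
    (hXinv : Integrable (fun ω => 1 / X ω) μ) (hXint : Integrable X μ)
    (p a : ℝ) (hp : 0 < p) (ha : 0 < a)
    (hY : HasLawGamma μ Y p (a / 2))
    (hVint : Integrable (vMY X Y) μ)
    (c : ℝ)
    (hc : μ[vMY X Y | MeasurableSpace.comap (uMY X Y) inferInstance] =ᵐ[μ] fun _ => c) :
    0 < c ∧ HasLawGIG μ X (-p) a (2 * p / c) := by
  have hcpos : 0 < c := regression_const_pos hXm hYm hXpos hYpos hVint hc
  refine ⟨hcpos, ?_⟩
  have hb : 0 < 2 * p / c := by positivity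
  have hposX : ∀ᵐ x ∂(μ.map X), 0 < x :=
    (ae_map_iff hXm.aemeasurable measurableSet_Ioi).2 hXpos
  have hinvX : Integrable (fun x => x⁻¹) (μ.map X) :=
    (integrable_map_measure (by fun_prop) hXm.aemeasurable).2 (by simpa [Function.comp_def] using hXinv)
  have := Measure.isProbabilityMeasure_map (μ := μ) hXm.aemeasurable
  have hposG := ae_pos_gigMeasure (-p) a (2 * p / c)
  obtain ⟨k, hk, heq⟩ := exists_smul_eq_of_laplace_ode hp hcpos (A := 1 + a / 2) (by linarith)
    (ae_pos_invExpTilt hposX) (integrable_exp_invExpTilt hposX hinvX)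
    (ae_pos_invExpTilt hposG)
    (integrable_exp_invExpTilt hposG (integrable_inv_gigMeasure ha hb))
    (invExpTilt_ne_zero hposX (IsProbabilityMeasure.ne_zero _))
    (invExpTilt_ne_zero hposG (gigMeasure_ne_zero _ _ _))
    (fun s hs => expMoment_map_ode hXm hYm hXpos hYpos hindep hp ha hY hVint hc hs)
    (fun s hs => expMoment_gigMeasure_ode hp ha hcpos hs)
  refine ⟨k, hk, ?_⟩
  rw [← withDensity_invExpTilt hposX, heq, withDensity_smul_measure,
    withDensity_invExpTilt hposG, gigMeasure,
    ← withDensity_smul _ (measurable_gigpdf _ _ _).ennreal_ofReal]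
  congr 1
  ext x
  rw [Pi.smul_apply, smul_eq_mul, ENNReal.ofReal_mul hk.le]
end

section
/- (Explicit form of the GIG scale MLE.) Let p ∈ ℝ, θ > 0, n ≥ 1 and x₁, …, x_n > 0. Set x̄ = (1/n)·Σ_{i=1}^n x_i and x̄₋₁ = (1/n)·Σ_{i=1}^n 1/x_i. Then the likelihood function η ↦ Π_{i=1}^n η^(−p) · x_i^(p−1) · exp(−θ·(x_i/η + η/x_i)/2), defined for η ∈ (0, ∞), attains its unique global maximum at η̂ = (√(p² + θ²·x̄·x̄₋₁) − p)/(θ·x̄₋₁). -/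
open MeasureTheory ProbabilityTheory Real Set Filter

/-- The sample mean `x̄ = (1/n) Σ xᵢ`. -/
noncomputable def sampleMean (n : ℕ) (x : Fin n → ℝ) : ℝ := (1 / n : ℝ) * ∑ i, x i

/-- The sample harmonic term `x̄₋₁ = (1/n) Σ 1/xᵢ`. -/
noncomputable def sampleMeanInv (n : ℕ) (x : Fin n → ℝ) : ℝ := (1 / n : ℝ) * ∑ i, (x i)⁻¹

/-- The candidate MLE `η̂ = (√(p² + θ² x̄ x̄₋₁) - p)/(θ x̄₋₁)`. -/
noncomputable def gigEtaHat (p θ : ℝ) (n : ℕ) (x : Fin n → ℝ) : ℝ :=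
  (Real.sqrt (p ^ 2 + θ ^ 2 * sampleMean n x * sampleMeanInv n x) - p)
    / (θ * sampleMeanInv n x)

/-- The GIG scale likelihood `η ↦ ∏ i, η^(-p) · xᵢ^(p-1) · exp(-θ(xᵢ/η + η/xᵢ)/2)`
(with the η-free normalizing constant removed). -/
noncomputable def gigScaleLik (p θ : ℝ) (n : ℕ) (x : Fin n → ℝ) (η : ℝ) : ℝ :=
  ∏ i, η ^ (-p) * x i ^ (p - 1) * Real.exp (-θ * (x i / η + η / x i) / 2)

lemma gigScaleLik_eq_exp (p θ : ℝ) {n : ℕ} (hn : n ≠ 0) {x : Fin n → ℝ} (hx : ∀ i, 0 < x i)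
    {η : ℝ} (hη : 0 < η) :
    gigScaleLik p θ n x η = Real.exp (∑ i, (p - 1) * Real.log (x i) +
      n * (-p * Real.log η - θ * (sampleMean n x / η + η * sampleMeanInv n x) / 2)) := by
  have hn' : (n : ℝ) ≠ 0 := Nat.cast_ne_zero.mpr hn
  have hterm : ∀ i, η ^ (-p) * x i ^ (p - 1) * Real.exp (-θ * (x i / η + η / x i) / 2) =
      Real.exp ((p - 1) * Real.log (x i) + (-p * Real.log η
        - (θ / (2 * η) * x i + θ * η / 2 * (x i)⁻¹))) := fun i ↦ by
    rw [Real.rpow_def_of_pos hη, Real.rpow_def_of_pos (hx i), ← Real.exp_add, ← Real.exp_add]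
    congr 1
    field_simp
    ring
  rw [gigScaleLik, Finset.prod_congr rfl fun i _ ↦ hterm i, ← Real.exp_sum]
  congr 1
  rw [Finset.sum_add_distrib, Finset.sum_sub_distrib, Finset.sum_add_distrib,
    ← Finset.mul_sum _ _ (θ / (2 * η)), ← Finset.mul_sum _ _ (θ * η / 2), sampleMean, sampleMeanInv]
  simp only [Finset.sum_const, Finset.card_univ, Fintype.card_fin, nsmul_eq_mul]
  field_simp

lemma sampleMean_pos {n : ℕ} (hn : 1 ≤ n) {x : Fin n → ℝ} (hx : ∀ i, 0 < x i) :
    0 < sampleMean n x := by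
  have : Nonempty (Fin n) := ⟨⟨0, hn⟩⟩
  have hn' : (0 : ℝ) < n := by exact_mod_cast hn
  exact mul_pos (by positivity) (Finset.sum_pos (fun i _ ↦ hx i) Finset.univ_nonempty)

lemma sampleMeanInv_pos {n : ℕ} (hn : 1 ≤ n) {x : Fin n → ℝ} (hx : ∀ i, 0 < x i) :
    0 < sampleMeanInv n x :=
  sampleMean_pos hn fun i ↦ inv_pos.mpr (hx i)

lemma gigEtaHat_pos (p : ℝ) {θ : ℝ} (hθ : 0 < θ) {n : ℕ} {x : Fin n → ℝ}
    (ha : 0 < sampleMean n x) (hb : 0 < sampleMeanInv n x) : 0 < gigEtaHat p θ n x := by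
  refine div_pos (sub_pos.mpr ?_) (mul_pos hθ hb)
  refine Real.lt_sqrt_of_sq_lt ?_
  have : 0 < θ ^ 2 * sampleMean n x * sampleMeanInv n x := by positivity
  linarith

/-- The score equation satisfied by the candidate MLE. -/
lemma gigEtaHat_score (p : ℝ) {θ : ℝ} (hθ : 0 < θ) {n : ℕ} {x : Fin n → ℝ}
    (ha : 0 < sampleMean n x) (hb : 0 < sampleMeanInv n x) :
    θ * sampleMeanInv n x * gigEtaHat p θ n x ^ 2 + 2 * p * gigEtaHat p θ n x
      = θ * sampleMean n x := by
  have hsq := Real.sq_sqrt (show 0 ≤ p ^ 2 + θ ^ 2 * sampleMean n x * sampleMeanInv n x by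
    positivity)
  rw [gigEtaHat]
  generalize Real.sqrt _ = r at hsq ⊢
  field_simp
  linear_combination hsq

/-- A positive solution of the score equation is the strict maximizer of the normalized
log-likelihood. -/
lemma gig_profile_lt {p θ a b s η : ℝ} (hθ : 0 < θ) (ha : 0 < a) (hb : 0 < b) (hs : 0 < s)
    (hη : 0 < η) (hne : η ≠ s) (hscore : θ * b * s ^ 2 + 2 * p * s = θ * a) :
    -p * Real.log η - θ * (a / η + η * b) / 2 < -p * Real.log s - θ * (a / s + s * b) / 2 := by
  have hp : p = θ * a / (2 * s) - θ * b * s / 2 := by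
    field_simp
    linear_combination hscore
  have h₁ : Real.log (η / s) < η / s - 1 :=
    Real.log_lt_sub_one_of_pos (by positivity) (by rwa [Ne, div_eq_one_iff_eq hs.ne'])
  have h₂ : Real.log (s / η) < s / η - 1 :=
    Real.log_lt_sub_one_of_pos (by positivity)
      (by rwa [Ne, div_eq_one_iff_eq hη.ne', eq_comm])
  rw [Real.log_div hη.ne' hs.ne'] at h₁
  rw [Real.log_div hs.ne' hη.ne'] at h₂
  have h₃ := mul_pos (show 0 < θ * b * s / 2 by positivity) (sub_pos.mpr h₁)
  have h₄ := mul_pos (show 0 < θ * a / (2 * s) by positivity) (sub_pos.mpr h₂)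
  rw [← sub_pos]
  refine (add_pos h₃ h₄).trans_eq ?_
  rw [hp]
  field_simp
  ring

/-- Explicit form of the MLE of the scale parameter `η` of the GIG distribution in the
`(p, θ, η)` parameterization: the likelihood attains its unique global maximum over
`(0, ∞)` at `η̂ = (√(p² + θ² x̄ x̄₋₁) - p)/(θ x̄₋₁)`. -/
theorem gig_scale_mle_explicit
    (p θ : ℝ) (hθ : 0 < θ) (n : ℕ) (hn : 1 ≤ n)
    (x : Fin n → ℝ) (hx : ∀ i, 0 < x i) :
    0 < gigEtaHat p θ n x ∧
      ∀ η : ℝ, 0 < η → η ≠ gigEtaHat p θ n x →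
        gigScaleLik p θ n x η < gigScaleLik p θ n x (gigEtaHat p θ n x) := by
  have ha := sampleMean_pos hn hx
  have hb := sampleMeanInv_pos hn hx
  have hs := gigEtaHat_pos p hθ ha hb
  refine ⟨hs, fun η hη hne ↦ ?_⟩
  have hn₀ : n ≠ 0 := Nat.one_le_iff_ne_zero.mp hn
  rw [gigScaleLik_eq_exp p θ hn₀ hx hη, gigScaleLik_eq_exp p θ hn₀ hx hs, Real.exp_lt_exp]
  have hlt := gig_profile_lt hθ ha hb hs hη hne (gigEtaHat_score p hθ ha hb)
  have hn' : (0 : ℝ) < n := by exact_mod_cast hn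
  gcongr
end
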